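/- arXiv:2303.16806 — 2 statements merged into one kernel-verified Lean document; each statement's English description precedes it below -/
import Mathlib

section
/- For a 2-player stage game G in which player 1 may use mixed strategies and player 2 may only use pure strategies (in the stage game and in all repeated games), there exist some T ≥ 1 and some subgame-perfect equilibrium of the repeated game G(T) in which local suboptimality occurs if and only if at least one of the following holds: (1) |V₁^{m,p}| > 1, |V₂^{m,p}| > 1, and there exist σ̂₁ ∈ ΔA₁, â₂ ∈ A₂ with (σ̂₁, â₂) ∉ Nash^{m,p}(G); OR (2) |V₁^{m,p}| > 1, |V₂^{m,p}| = 1, and there exist σ̂₁ ∈ ΔA₁, a₁′ ∈ A₁, â₂ ∈ A₂ such that (a) u₁(σ̂₁, â₂) < u₁(a₁′, â₂), (b) â₂ is a best response (among pure strategies) to σ̂₁, and (c) if |S_{σ̂₁}| > 1 then, letting D = { u₁(σ) − u₁(σ′) : σ, σ′ ∈ Nash^{m,p}(G) }, there exists a ∈ S_{σ̂₁} such that for every a′ ∈ S_{σ̂₁} \ {a} there exist an integer n_{a′} ≥ 0 and d₁^{a′}, …, d_{n_{a′}}^{a′} ∈ D with u₁(a, â₂) − u₁(a′, â₂) = Σ_{k=1}^{n_{a′}}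 d_k^{a′}; OR (3) |V₁^{m,p}| = 1, |V₂^{m,p}| > 1, and there exist σ̂₁ ∈ ΔA₁ and â₂, a₂′ ∈ A₂ with u₂(σ̂₁, â₂) < u₂(σ̂₁, a₂′) and σ̂₁ a best response (among mixed strategies) to â₂. -/
open Finset

/-- A mixed strategy on a finite action set: a probability distribution. -/
structure Mix (A : Type*) [Fintype A] where
  p : A → ℝ
  nonneg : ∀ a, 0 ≤ p a
  sum_one : ∑ a, p a = 1

namespace Mix

/-- The Dirac (pure) mixed strategy at an action. -/
def pure {A : Type*} [Fintype A] [DecidableEq A] (a : A) : Mix A where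
  p := fun b => if b = a then 1 else 0
  nonneg := by intro b; by_cases hb : b = a <;> simp [hb]
  sum_one := by simp

/-- The support of a mixed strategy. -/
def support {A : Type*} [Fintype A] (σ : Mix A) : Set A := {a | 0 < σ.p a}

end Mix

section TwoPlayer

variable {A₁ A₂ : Type*} [Fintype A₁] [Fintype A₂] [DecidableEq A₁] [DecidableEq A₂]

/-- Expected payoff under a mixed strategy profile. -/
def expPay (u : A₁ → A₂ → ℝ) (σ₁ : Mix A₁) (σ₂ : Mix A₂) : ℝ :=
  ∑ a₁, ∑ a₂, σ₁.p a₁ * σ₂.p a₂ * u a₁ a₂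

/-- Player 1's pure action `a₁` is a best response among pure strategies to `a₂`. -/
def BR1p (u₁ : A₁ → A₂ → ℝ) (a₁ : A₁) (a₂ : A₂) : Prop := ∀ b₁, u₁ b₁ a₂ ≤ u₁ a₁ a₂

/-- Player 2's pure action `a₂` is a best response among pure strategies to `a₁`. -/
def BR2p (u₂ : A₁ → A₂ → ℝ) (a₁ : A₁) (a₂ : A₂) : Prop := ∀ b₂, u₂ a₁ b₂ ≤ u₂ a₁ a₂

/-- Player 1's mixed strategy `σ₁` is a best response (among mixed strategies) to `σ₂`. -/
def BR1m (u₁ : A₁ → A₂ → ℝ) (σ₁ : Mix A₁) (σ₂ : Mix A₂) : Prop :=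
  ∀ τ₁ : Mix A₁, expPay u₁ τ₁ σ₂ ≤ expPay u₁ σ₁ σ₂

/-- Player 2's mixed strategy `σ₂` is a best response (among mixed strategies) to `σ₁`. -/
def BR2m (u₂ : A₁ → A₂ → ℝ) (σ₁ : Mix A₁) (σ₂ : Mix A₂) : Prop :=
  ∀ τ₂ : Mix A₂, expPay u₂ σ₁ τ₂ ≤ expPay u₂ σ₁ σ₂

/-- Player 2's pure action `a₂` is a best response among pure strategies to mixed `σ₁`. -/
def BR2pm (u₂ : A₁ → A₂ → ℝ) (σ₁ : Mix A₁) (a₂ : A₂) : Prop :=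
  ∀ b₂ : A₂, expPay u₂ σ₁ (Mix.pure b₂) ≤ expPay u₂ σ₁ (Mix.pure a₂)

/-- Pure Nash equilibria (both players restricted to pure strategies). -/
def NashPP (u₁ u₂ : A₁ → A₂ → ℝ) : Set (A₁ × A₂) :=
  {q | BR1p u₁ q.1 q.2 ∧ BR2p u₂ q.1 q.2}

/-- Nash equilibria when player 1 is mixed and player 2 is pure. -/
def NashMP (u₁ u₂ : A₁ → A₂ → ℝ) : Set (Mix A₁ × A₂) :=
  {q | BR1m u₁ q.1 (Mix.pure q.2) ∧ BR2pm u₂ q.1 q.2}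

/-- Mixed Nash equilibria. -/
def NashMM (u₁ u₂ : A₁ → A₂ → ℝ) : Set (Mix A₁ × Mix A₂) :=
  {q | BR1m u₁ q.1 q.2 ∧ BR2m u₂ q.1 q.2}

def V1pp (u₁ u₂ : A₁ → A₂ → ℝ) : Set ℝ := (fun q => u₁ q.1 q.2) '' NashPP u₁ u₂
def V2pp (u₁ u₂ : A₁ → A₂ → ℝ) : Set ℝ := (fun q => u₂ q.1 q.2) '' NashPP u₁ u₂
def V1mp (u₁ u₂ : A₁ → A₂ → ℝ) : Set ℝ :=
  (fun q => expPay u₁ q.1 (Mix.pure q.2)) '' NashMP u₁ u₂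
def V2mp (u₁ u₂ : A₁ → A₂ → ℝ) : Set ℝ :=
  (fun q => expPay u₂ q.1 (Mix.pure q.2)) '' NashMP u₁ u₂
def V1mm (u₁ u₂ : A₁ → A₂ → ℝ) : Set ℝ := (fun q => expPay u₁ q.1 q.2) '' NashMM u₁ u₂
def V2mm (u₁ u₂ : A₁ → A₂ → ℝ) : Set ℝ := (fun q => expPay u₂ q.1 q.2) '' NashMM u₁ u₂

/-- The set `V` is a singleton, i.e. `|V| = 1`. -/
def oneVal (V : Set ℝ) : Prop := ∃ v, V = {v}

/-- A history of play: a finite sequence of pure action profiles. -/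
abbrev Hist (A₁ A₂ : Type*) := List (A₁ × A₂)

/-- A pure behavior strategy for player 1, seen as a mixed behavior strategy. -/
def pureBeh1 (μ : Hist A₁ A₂ → A₁) : Hist A₁ A₂ → Mix A₁ := fun h => Mix.pure (μ h)

/-- A pure behavior strategy for player 2, seen as a mixed behavior strategy. -/
def pureBeh2 (μ : Hist A₁ A₂ → A₂) : Hist A₁ A₂ → Mix A₂ := fun h => Mix.pure (μ h)

/-- Expected total payoff (w.r.t. `u`) over `T` remaining rounds, after history `h`. -/
def totPay (u : A₁ → A₂ → ℝ) (μ₁ : Hist A₁ A₂ → Mix A₁) (μ₂ : Hist A₁ A₂ → Mix A₂) :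
    ℕ → Hist A₁ A₂ → ℝ
  | 0, _ => 0
  | T + 1, h =>
      ∑ a₁, ∑ a₂, (μ₁ h).p a₁ * (μ₂ h).p a₂ * (u a₁ a₂ + totPay u μ₁ μ₂ T (h ++ [(a₁, a₂)]))

/-- The behavior strategy induced on the subgame following history `h`. -/
def condS {A₁ A₂ α : Type*} (μ : Hist A₁ A₂ → α) (h : Hist A₁ A₂) : Hist A₁ A₂ → α :=
  fun h' => μ (h ++ h')

/-- Nash equilibrium of the `T`-round repeated game, both players mixed. -/
def isNEmm (u₁ u₂ : A₁ → A₂ → ℝ) (T : ℕ)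
    (μ₁ : Hist A₁ A₂ → Mix A₁) (μ₂ : Hist A₁ A₂ → Mix A₂) : Prop :=
  (∀ μ₁' : Hist A₁ A₂ → Mix A₁, totPay u₁ μ₁' μ₂ T [] ≤ totPay u₁ μ₁ μ₂ T []) ∧
  (∀ μ₂' : Hist A₁ A₂ → Mix A₂, totPay u₂ μ₁ μ₂' T [] ≤ totPay u₂ μ₁ μ₂ T [])

/-- Subgame-perfect equilibrium of the `T`-round repeated game, both players mixed. -/
def isSPEmm (u₁ u₂ : A₁ → A₂ → ℝ) (T : ℕ)
    (μ₁ : Hist A₁ A₂ → Mix A₁) (μ₂ : Hist A₁ A₂ → Mix A₂) : Prop :=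
  ∀ h : Hist A₁ A₂, h.length < T → isNEmm u₁ u₂ (T - h.length) (condS μ₁ h) (condS μ₂ h)

/-- Nash equilibrium of the `T`-round repeated game, player 1 mixed and player 2 pure. -/
def isNEmp (u₁ u₂ : A₁ → A₂ → ℝ) (T : ℕ)
    (μ₁ : Hist A₁ A₂ → Mix A₁) (μ₂ : Hist A₁ A₂ → A₂) : Prop :=
  (∀ μ₁' : Hist A₁ A₂ → Mix A₁,
      totPay u₁ μ₁' (pureBeh2 μ₂) T [] ≤ totPay u₁ μ₁ (pureBeh2 μ₂) T []) ∧
  (∀ μ₂' : Hist A₁ A₂ → A₂,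
      totPay u₂ μ₁ (pureBeh2 μ₂') T [] ≤ totPay u₂ μ₁ (pureBeh2 μ₂) T [])

/-- SPE of the `T`-round repeated game, player 1 mixed and player 2 pure. -/
def isSPEmp (u₁ u₂ : A₁ → A₂ → ℝ) (T : ℕ)
    (μ₁ : Hist A₁ A₂ → Mix A₁) (μ₂ : Hist A₁ A₂ → A₂) : Prop :=
  ∀ h : Hist A₁ A₂, h.length < T → isNEmp u₁ u₂ (T - h.length) (condS μ₁ h) (condS μ₂ h)

/-- Nash equilibrium of the `T`-round repeated game, both players pure. -/
def isNEpp (u₁ u₂ : A₁ → A₂ → ℝ) (T : ℕ)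
    (μ₁ : Hist A₁ A₂ → A₁) (μ₂ : Hist A₁ A₂ → A₂) : Prop :=
  (∀ μ₁' : Hist A₁ A₂ → A₁,
      totPay u₁ (pureBeh1 μ₁') (pureBeh2 μ₂) T [] ≤
        totPay u₁ (pureBeh1 μ₁) (pureBeh2 μ₂) T []) ∧
  (∀ μ₂' : Hist A₁ A₂ → A₂,
      totPay u₂ (pureBeh1 μ₁) (pureBeh2 μ₂') T [] ≤
        totPay u₂ (pureBeh1 μ₁) (pureBeh2 μ₂) T [])

/-- SPE of the `T`-round repeated game, both players pure. -/
def isSPEpp (u₁ u₂ : A₁ → A₂ → ℝ) (T : ℕ)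
    (μ₁ : Hist A₁ A₂ → A₁) (μ₂ : Hist A₁ A₂ → A₂) : Prop :=
  ∀ h : Hist A₁ A₂, h.length < T → isNEpp u₁ u₂ (T - h.length) (condS μ₁ h) (condS μ₂ h)

/-- `G ∈ 𝒢_LS^{p,p}`: local suboptimality occurs in some SPE of some `G(T)`,
both players restricted to pure strategies. -/
def GLSpp (u₁ u₂ : A₁ → A₂ → ℝ) : Prop :=
  ∃ T : ℕ, 1 ≤ T ∧ ∃ (μ₁ : Hist A₁ A₂ → A₁) (μ₂ : Hist A₁ A₂ → A₂),
    isSPEpp u₁ u₂ T μ₁ μ₂ ∧ ∃ h : Hist A₁ A₂, h.length < T ∧ (μ₁ h, μ₂ h) ∉ NashPP u₁ u₂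

/-- `G ∈ 𝒢_LS^{m,p}`: local suboptimality occurs in some SPE of some `G(T)`,
player 1 mixed and player 2 pure. -/
def GLSmp (u₁ u₂ : A₁ → A₂ → ℝ) : Prop :=
  ∃ T : ℕ, 1 ≤ T ∧ ∃ (μ₁ : Hist A₁ A₂ → Mix A₁) (μ₂ : Hist A₁ A₂ → A₂),
    isSPEmp u₁ u₂ T μ₁ μ₂ ∧ ∃ h : Hist A₁ A₂, h.length < T ∧ (μ₁ h, μ₂ h) ∉ NashMP u₁ u₂

/-- `G ∈ 𝒢_LS^{m,m}`: local suboptimality occurs in some SPE of some `G(T)`,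
both players mixed. -/
def GLSmm (u₁ u₂ : A₁ → A₂ → ℝ) : Prop :=
  ∃ T : ℕ, 1 ≤ T ∧ ∃ (μ₁ : Hist A₁ A₂ → Mix A₁) (μ₂ : Hist A₁ A₂ → Mix A₂),
    isSPEmm u₁ u₂ T μ₁ μ₂ ∧ ∃ h : Hist A₁ A₂, h.length < T ∧ (μ₁ h, μ₂ h) ∉ NashMM u₁ u₂

/-- The pure-pure characterization condition (condition of the pure-strategy theorem). -/
def condPP (u₁ u₂ : A₁ → A₂ → ℝ) : Prop :=
  ((V1pp u₁ u₂).Nontrivial ∧ (V2pp u₁ u₂).Nontrivial ∧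
    ∃ (a₁ : A₁) (a₂ : A₂), (a₁, a₂) ∉ NashPP u₁ u₂) ∨
  ((V1pp u₁ u₂).Nontrivial ∧ oneVal (V2pp u₁ u₂) ∧
    ∃ (a₁ a₁' : A₁) (a₂ : A₂), u₁ a₁ a₂ < u₁ a₁' a₂ ∧ BR2p u₂ a₁ a₂) ∨
  (oneVal (V1pp u₁ u₂) ∧ (V2pp u₁ u₂).Nontrivial ∧
    ∃ (a₁ : A₁) (a₂ a₂' : A₂), u₂ a₁ a₂ < u₂ a₁ a₂' ∧ BR1p u₁ a₁ a₂)

/-- The mixed-mixed characterization condition (condition of the general-case theorem). -/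
def condMM (u₁ u₂ : A₁ → A₂ → ℝ) : Prop :=
  ((V1mm u₁ u₂).Nontrivial ∧ (V2mm u₁ u₂).Nontrivial ∧
    ∃ (σ₁ : Mix A₁) (σ₂ : Mix A₂), (σ₁, σ₂) ∉ NashMM u₁ u₂) ∨
  ((V1mm u₁ u₂).Nontrivial ∧ oneVal (V2mm u₁ u₂) ∧
    ∃ (σ₁ : Mix A₁) (σ₂ : Mix A₂) (a₁' : A₁),
      expPay u₁ σ₁ σ₂ < expPay u₁ (Mix.pure a₁') σ₂ ∧ BR2m u₂ σ₁ σ₂) ∨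
  (oneVal (V1mm u₁ u₂) ∧ (V2mm u₁ u₂).Nontrivial ∧
    ∃ (σ₁ : Mix A₁) (σ₂ : Mix A₂) (a₂' : A₂),
      expPay u₂ σ₁ σ₂ < expPay u₂ σ₁ (Mix.pure a₂') ∧ BR1m u₁ σ₁ σ₂)

/-- The set `D` of differences of player 1's payoffs between pairs of stage-game
Nash equilibria (mixed-pure case). -/
def Dmp (u₁ u₂ : A₁ → A₂ → ℝ) : Set ℝ :=
  {x | ∃ q ∈ NashMP u₁ u₂, ∃ q' ∈ NashMP u₁ u₂,
    x = expPay u₁ q.1 (Mix.pure q.2) - expPay u₁ q'.1 (Mix.pure q'.2)}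

/-- `x` is a finite (possibly empty) sum of elements of `D`. -/
def sumOfD (D : Set ℝ) (x : ℝ) : Prop :=
  ∃ (n : ℕ) (d : Fin n → ℝ), (∀ k, d k ∈ D) ∧ x = ∑ k, d k

/-- The mixed-pure characterization condition (condition of the
pure-strategy-against-mixed-strategy theorem). -/
def condMP (u₁ u₂ : A₁ → A₂ → ℝ) : Prop :=
  ((V1mp u₁ u₂).Nontrivial ∧ (V2mp u₁ u₂).Nontrivial ∧
    ∃ (σ₁ : Mix A₁) (a₂ : A₂), (σ₁, a₂) ∉ NashMP u₁ u₂) ∨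
  ((V1mp u₁ u₂).Nontrivial ∧ oneVal (V2mp u₁ u₂) ∧
    ∃ (σ₁ : Mix A₁) (a₁' : A₁) (a₂ : A₂),
      expPay u₁ σ₁ (Mix.pure a₂) < u₁ a₁' a₂ ∧
      BR2pm u₂ σ₁ a₂ ∧
      (σ₁.support.Nontrivial →
        ∃ a ∈ σ₁.support, ∀ a' ∈ σ₁.support, a' ≠ a →
          sumOfD (Dmp u₁ u₂) (u₁ a a₂ - u₁ a' a₂))) ∨
  (oneVal (V1mp u₁ u₂) ∧ (V2mp u₁ u₂).Nontrivial ∧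
    ∃ (σ₁ : Mix A₁) (a₂ a₂' : A₂),
      expPay u₂ σ₁ (Mix.pure a₂) < expPay u₂ σ₁ (Mix.pure a₂') ∧
      BR1m u₁ σ₁ (Mix.pure a₂))

/-- A history is reachable under the behavior profile `(μ₁, μ₂)` (mixed-pure case):
every action of player 1 along it has positive probability and every action of
player 2 along it is the prescribed one. -/
def reachableMP (μ₁ : Hist A₁ A₂ → Mix A₁) (μ₂ : Hist A₁ A₂ → A₂) (h : Hist A₁ A₂) : Prop :=
  ∀ k : Fin h.length, 0 < (μ₁ (h.take k.val)).p (h.get k).1 ∧ μ₂ (h.take k.val) = (h.get k).2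

end TwoPlayer


section ListPay

set_option linter.unusedSectionVars false

variable {A₁ A₂ : Type*} [Fintype A₁] [Fintype A₂] [DecidableEq A₁] [DecidableEq A₂]

theorem Mix.support_nonempty {A : Type*} [Fintype A] (σ : Mix A) : σ.support.Nonempty := by
  by_contra h
  have h0 : ∀ a, σ.p a = 0 := fun a =>
    le_antisymm (not_lt.1 fun ha => h ⟨a, ha⟩) (σ.nonneg a)
  simpa [h0] using σ.sum_one

theorem Mix.support_pure {A : Type*} [Fintype A] [DecidableEq A] (a : A) :
    (Mix.pure a).support = {a} := by
  ext b
  by_cases hb : b = a <;> simp [Mix.support, Mix.pure, hb]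

theorem Mix.sum_mul_const {A : Type*} [Fintype A] (σ : Mix A) (c : ℝ) :
    ∑ a, σ.p a * c = c := by
  rw [← Finset.sum_mul, σ.sum_one, one_mul]

theorem Mix.eq_zero_of_notMem_support {A : Type*} [Fintype A] {σ : Mix A} {a : A}
    (ha : a ∉ σ.support) : σ.p a = 0 :=
  le_antisymm (not_lt.1 ha) (σ.nonneg a)

theorem expPay_pure_right (f : A₁ → A₂ → ℝ) (σ : Mix A₁) (b : A₂) :
    expPay f σ (Mix.pure b) = ∑ a, σ.p a * f a b := by
  simp [expPay, Mix.pure]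

theorem expPay_pure_pure (f : A₁ → A₂ → ℝ) (a : A₁) (b : A₂) :
    expPay f (Mix.pure a) (Mix.pure b) = f a b := by
  rw [expPay_pure_right]
  simp [Mix.pure]

theorem expPay_add_right (f : A₁ → A₂ → ℝ) (g : A₂ → ℝ) (σ : Mix A₁) (b : A₂) :
    expPay (fun a b => f a b + g b) σ (Mix.pure b) = expPay f σ (Mix.pure b) + g b := by
  simp only [expPay_pure_right, mul_add, Finset.sum_add_distrib, Mix.sum_mul_const]

theorem expPay_eq_of_forall_support {f : A₁ → A₂ → ℝ} {σ : Mix A₁} {b : A₂} {c : ℝ}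
    (h : ∀ a ∈ σ.support, f a b = c) : expPay f σ (Mix.pure b) = c := by
  rw [expPay_pure_right, ← σ.sum_mul_const c]
  refine Finset.sum_congr rfl fun a _ => ?_
  by_cases ha : a ∈ σ.support
  · rw [h a ha]
  · rw [Mix.eq_zero_of_notMem_support ha, zero_mul, zero_mul]

theorem BR1m.expPay_eq {f : A₁ → A₂ → ℝ} {σ : Mix A₁} {b : A₂}
    (h : BR1m f σ (Mix.pure b)) {a : A₁} (ha : a ∈ σ.support) :
    expPay f σ (Mix.pure b) = f a b := by
  set E := expPay f σ (Mix.pure b) with hE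
  have hle : ∀ a', f a' b ≤ E := fun a' => by
    simpa only [expPay_pure_pure] using h (Mix.pure a')
  have hsum : ∑ a', σ.p a' * (E - f a' b) = 0 := by
    simp only [mul_sub, Finset.sum_sub_distrib, Mix.sum_mul_const]
    rw [hE, expPay_pure_right, sub_self]
  have h0 := (Finset.sum_eq_zero_iff_of_nonneg fun a' _ =>
    mul_nonneg (σ.nonneg a') (sub_nonneg.2 (hle a'))).1 hsum a (Finset.mem_univ a)
  rcases mul_eq_zero.1 h0 with h1 | h1
  · exact absurd h1 (ne_of_gt ha)
  · linarith

/-- A mixed strategy is a best response to a pure one iff every action in its support is. -/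
theorem BR1m_pure_iff {f : A₁ → A₂ → ℝ} {σ : Mix A₁} {b : A₂} :
    BR1m f σ (Mix.pure b) ↔ ∀ a ∈ σ.support, ∀ a', f a' b ≤ f a b := by
  refine ⟨fun h a ha a' => ?_, fun h τ => ?_⟩
  · rw [← h.expPay_eq ha]
    simpa only [expPay_pure_pure] using h (Mix.pure a')
  · obtain ⟨a, ha⟩ := σ.support_nonempty
    rw [expPay_eq_of_forall_support fun a' ha' => le_antisymm (h a ha a') (h a' ha' a),
      expPay_pure_right, ← τ.sum_mul_const (f a b)]
    exact Finset.sum_le_sum fun a' _ => mul_le_mul_of_nonneg_left (h a ha a') (τ.nonneg a')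

theorem BR1m_add_right_iff {f : A₁ → A₂ → ℝ} {g : A₂ → ℝ} {σ : Mix A₁} {b : A₂} :
    BR1m (fun a b => f a b + g b) σ (Mix.pure b) ↔ BR1m f σ (Mix.pure b) := by
  simp only [BR1m, expPay_add_right, add_le_add_iff_right]

theorem BR2pm_add_const_iff {f : A₁ → A₂ → ℝ} {c : ℝ} {σ : Mix A₁} {b : A₂} :
    BR2pm (fun a b => f a b + c) σ b ↔ BR2pm f σ b := by
  simp only [BR2pm, expPay_add_right f fun _ => c, add_le_add_iff_right]

theorem mem_NashMP_add_const_iff {f₁ f₂ : A₁ → A₂ → ℝ} {c₁ c₂ : ℝ} {q : Mix A₁ × A₂} :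
    q ∈ NashMP (fun a b => f₁ a b + c₁) (fun a b => f₂ a b + c₂) ↔ q ∈ NashMP f₁ f₂ :=
  and_congr (BR1m_add_right_iff (g := fun _ => c₁)) BR2pm_add_const_iff

/-- If some profile is not an equilibrium, then some pure profile is not an equilibrium. -/
theorem exists_pure_notMem_NashMP {u₁ u₂ : A₁ → A₂ → ℝ} {q : Mix A₁ × A₂}
    (hq : q ∉ NashMP u₁ u₂) : ∃ a b, (Mix.pure a, b) ∉ NashMP u₁ u₂ := by
  by_contra! h
  refine hq ⟨BR1m_pure_iff.2 fun a _ a' => ?_, fun b => ?_⟩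
  · exact BR1m_pure_iff.1 (h a q.2).1 a (by simp [Mix.support_pure]) a'
  · simp only [expPay_pure_right]
    refine Finset.sum_le_sum fun a _ => mul_le_mul_of_nonneg_left ?_ (q.1.nonneg a)
    simpa only [expPay_pure_pure] using (h a q.2).2 b

/-- Total payoff when the stage profiles in a list are played one after the other. -/
def listPay (u : A₁ → A₂ → ℝ) (l : List (Mix A₁ × A₂)) : ℝ :=
  (l.map fun q => expPay u q.1 (Mix.pure q.2)).sum

@[simp]
theorem listPay_nil (u : A₁ → A₂ → ℝ) : listPay u [] = 0 := rfl

@[simp]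
theorem listPay_cons (u : A₁ → A₂ → ℝ) (q : Mix A₁ × A₂) (l : List (Mix A₁ × A₂)) :
    listPay u (q :: l) = expPay u q.1 (Mix.pure q.2) + listPay u l := by
  simp [listPay]

theorem listPay_append (u : A₁ → A₂ → ℝ) (l l' : List (Mix A₁ × A₂)) :
    listPay u (l ++ l') = listPay u l + listPay u l' := by
  simp [listPay]

theorem listPay_replicate (u : A₁ → A₂ → ℝ) (k : ℕ) (q : Mix A₁ × A₂) :
    listPay u (List.replicate k q) = k * expPay u q.1 (Mix.pure q.2) := by
  simp [listPay]

theorem listPay_flatMap {ι : Type*} (u : A₁ → A₂ → ℝ) (s : List ι)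
    (L : ι → List (Mix A₁ × A₂)) :
    listPay u (s.flatMap L) = (s.map fun i => listPay u (L i)).sum := by
  induction s with
  | nil => simp
  | cons i s ih => simp [listPay_append, ih]

theorem listPay_eq_length_mul {u : A₁ → A₂ → ℝ} {v : ℝ} {l : List (Mix A₁ × A₂)}
    (h : ∀ q ∈ l, expPay u q.1 (Mix.pure q.2) = v) : listPay u l = l.length * v := by
  induction l with
  | nil => simp
  | cons q l ih =>
    rw [listPay_cons, h q (by simp), ih fun q' hq' => h q' (by simp [hq']), List.length_cons]
    push_cast
    ring

/-- Finite sums of elements of `D` are payoff differences between equally long lists of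
stage equilibria. -/
theorem sumOfD_Dmp_iff {u₁ u₂ : A₁ → A₂ → ℝ} {x : ℝ} :
    sumOfD (Dmp u₁ u₂) x ↔ ∃ l l' : List (Mix A₁ × A₂), (∀ q ∈ l, q ∈ NashMP u₁ u₂) ∧
      (∀ q ∈ l', q ∈ NashMP u₁ u₂) ∧ l.length = l'.length ∧ x = listPay u₁ l - listPay u₁ l' := by
  constructor
  · rintro ⟨n, d, hd, rfl⟩
    choose q hq q' hq' hqq using hd
    refine ⟨List.ofFn q, List.ofFn q', ?_, ?_, by simp, ?_⟩
    · simpa [List.mem_ofFn] using hq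
    · simpa [List.mem_ofFn] using hq'
    · simp [listPay, List.map_ofFn, List.sum_ofFn, hqq]
  · rintro ⟨l, l', hl, hl', hlen, rfl⟩
    induction l generalizing l' with
    | nil =>
      obtain rfl : l' = [] := List.length_eq_zero_iff.1 hlen.symm
      exact ⟨0, Fin.elim0, fun k => k.elim0, by simp⟩
    | cons q l ih =>
      cases l' with
      | nil => simp at hlen
      | cons q' l' =>
        obtain ⟨n, d, hd, hs⟩ := ih l' (fun r hr => hl r (by simp [hr]))
          (fun r hr => hl' r (by simp [hr])) (by simpa using hlen)
        refine ⟨n + 1, Fin.cons (expPay u₁ q.1 (Mix.pure q.2) - expPay u₁ q'.1 (Mix.pure q'.2)) d,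
          fun k => ?_, ?_⟩
        · refine Fin.cases ?_ (fun i => ?_) k
          · exact ⟨q, hl q (by simp), q', hl' q' (by simp), by simp⟩
          · simpa using hd i
        · rw [Fin.sum_univ_succ]
          simp only [Fin.cons_zero, Fin.cons_succ, listPay_cons, ← hs]
          ring

end ListPay

section OneShot

set_option linter.unusedSectionVars false

variable {A₁ A₂ : Type*} [Fintype A₁] [Fintype A₂] [DecidableEq A₁] [DecidableEq A₂]

/-- Payoff of the current round plus the payoff of the `n` rounds that follow it. -/
def augPay (u : A₁ → A₂ → ℝ) (μ₁ : Hist A₁ A₂ → Mix A₁) (μ₂ : Hist A₁ A₂ → A₂) (n : ℕ)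
    (h : Hist A₁ A₂) : A₁ → A₂ → ℝ :=
  fun a b => u a b + totPay u μ₁ (pureBeh2 μ₂) n (h ++ [(a, b)])

theorem totPay_succ (u : A₁ → A₂ → ℝ) (μ₁ : Hist A₁ A₂ → Mix A₁) (μ₂ : Hist A₁ A₂ → A₂)
    (n : ℕ) (h : Hist A₁ A₂) :
    totPay u μ₁ (pureBeh2 μ₂) (n + 1) h =
      expPay (augPay u μ₁ μ₂ n h) (μ₁ h) (Mix.pure (μ₂ h)) := rfl

theorem condS_drop {B₁ B₂ α : Type*} (ν : Hist B₁ B₂ → α) (h : Hist B₁ B₂) :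
    condS (fun g => ν (g.drop h.length)) h = ν := by
  funext g
  simp [condS]

theorem totPay_condS (u : A₁ → A₂ → ℝ) (μ₁ : Hist A₁ A₂ → Mix A₁) (μ₂ : Hist A₁ A₂ → Mix A₂)
    (n : ℕ) (h g : Hist A₁ A₂) :
    totPay u (condS μ₁ h) (condS μ₂ h) n g = totPay u μ₁ μ₂ n (h ++ g) := by
  induction n generalizing g with
  | zero => rfl
  | succ n ih => simp only [totPay, ih, condS, List.append_assoc]

theorem totPay_congr {u : A₁ → A₂ → ℝ} {μ₁ ν₁ : Hist A₁ A₂ → Mix A₁}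
    {μ₂ ν₂ : Hist A₁ A₂ → Mix A₂} {h : Hist A₁ A₂} (h₁ : condS μ₁ h = condS ν₁ h)
    (h₂ : condS μ₂ h = condS ν₂ h) (n : ℕ) :
    totPay u μ₁ μ₂ n h = totPay u ν₁ ν₂ n h := by
  have e := totPay_condS u μ₁ μ₂ n h []
  rw [h₁, h₂, totPay_condS, List.append_nil] at e
  exact e.symm

theorem expPay_mono {f g : A₁ → A₂ → ℝ} (hfg : ∀ a b, f a b ≤ g a b) (σ : Mix A₁) (τ : Mix A₂) :
    expPay f σ τ ≤ expPay g σ τ :=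
  Finset.sum_le_sum fun a _ => Finset.sum_le_sum fun b _ =>
    mul_le_mul_of_nonneg_left (hfg a b) (mul_nonneg (σ.nonneg a) (τ.nonneg b))

/-- The one-shot deviation principle. -/
theorem isSPEmp_iff_oneShot {u₁ u₂ : A₁ → A₂ → ℝ} {T : ℕ} {μ₁ : Hist A₁ A₂ → Mix A₁}
    {μ₂ : Hist A₁ A₂ → A₂} :
    isSPEmp u₁ u₂ T μ₁ μ₂ ↔ ∀ (h : Hist A₁ A₂) (n : ℕ), h.length + n + 1 = T →
      (μ₁ h, μ₂ h) ∈ NashMP (augPay u₁ μ₁ μ₂ n h) (augPay u₂ μ₁ μ₂ n h) := by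
  constructor
  · intro H h n hT
    obtain ⟨H₁, H₂⟩ := H h (by omega)
    have hn : T - h.length = n + 1 := by omega
    rw [hn] at H₁ H₂
    have hμ : ∀ u : A₁ → A₂ → ℝ,
        totPay u (condS μ₁ h) (pureBeh2 (condS μ₂ h)) (n + 1) [] =
          expPay (augPay u μ₁ μ₂ n h) (μ₁ h) (Mix.pure (μ₂ h)) := fun u => by
      have := totPay_condS u μ₁ (pureBeh2 μ₂) (n + 1) h []
      rwa [List.append_nil, totPay_succ] at this
    have hcont : ∀ (u : A₁ → A₂ → ℝ) (ν₁ : Hist A₁ A₂ → Mix A₁) (ν₂ : Hist A₁ A₂ → A₂),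
        (∀ o g, ν₁ (o :: g) = condS μ₁ h (o :: g)) → (∀ o g, ν₂ (o :: g) = condS μ₂ h (o :: g)) →
        augPay u ν₁ ν₂ n [] = augPay u μ₁ μ₂ n h := by
      intro u ν₁ ν₂ h₁ h₂
      funext a b
      unfold augPay
      rw [← totPay_condS u μ₁ (pureBeh2 μ₂) n h]
      congr 1
      apply totPay_congr
      · funext g
        exact h₁ (a, b) g
      · funext g
        exact congrArg Mix.pure (h₂ (a, b) g)
    refine ⟨fun τ => ?_, fun b => ?_⟩
    · have := H₁ (Function.update (condS μ₁ h) [] τ)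
      rw [hμ, totPay_succ, hcont u₁ _ _ (by simp) (by simp)] at this
      simpa [condS] using this
    · have := H₂ (Function.update (condS μ₂ h) [] b)
      rw [hμ, totPay_succ, hcont u₂ _ _ (by simp) (by simp)] at this
      simpa [condS] using this
  · intro H
    have key₁ : ∀ (n : ℕ) (h : Hist A₁ A₂), h.length + n = T → ∀ ν : Hist A₁ A₂ → Mix A₁,
        totPay u₁ ν (pureBeh2 μ₂) n h ≤ totPay u₁ μ₁ (pureBeh2 μ₂) n h := by
      intro n
      induction n with
      | zero => intro h _ ν; exact le_rfl
      | succ n ih =>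
        intro h hT ν
        rw [totPay_succ, totPay_succ]
        refine (expPay_mono (fun a b => ?_) _ _).trans ((H h n hT).1 (ν h))
        exact add_le_add le_rfl (ih _ (by simp; omega) ν)
    have key₂ : ∀ (n : ℕ) (h : Hist A₁ A₂), h.length + n = T → ∀ ν : Hist A₁ A₂ → A₂,
        totPay u₂ μ₁ (pureBeh2 ν) n h ≤ totPay u₂ μ₁ (pureBeh2 μ₂) n h := by
      intro n
      induction n with
      | zero => intro h _ ν; exact le_rfl
      | succ n ih =>
        intro h hT ν
        rw [totPay_succ, totPay_succ]
        refine (expPay_mono (fun a b => ?_) _ _).trans ((H h n hT).2 (ν h))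
        exact add_le_add le_rfl (ih _ (by simp; omega) ν)
    intro h hh
    refine ⟨fun ν => ?_, fun ν => ?_⟩
    · have := key₁ (T - h.length) h (by omega) fun g => ν (g.drop h.length)
      rw [← List.append_nil h, ← totPay_condS, ← totPay_condS, List.append_nil,
        condS_drop] at this
      exact this
    · have := key₂ (T - h.length) h (by omega) fun g => ν (g.drop h.length)
      rw [← List.append_nil h, ← totPay_condS, ← totPay_condS, List.append_nil] at this
      have e : condS (pureBeh2 fun g => ν (g.drop h.length)) h = pureBeh2 ν := by
        change pureBeh2 (condS (fun g => ν (g.drop h.length)) h) = _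
        rw [condS_drop]
      rw [e] at this
      exact this

end OneShot

section Sufficiency

variable {A₁ A₂ : Type*} [Fintype A₁] [Fintype A₂] [DecidableEq A₁] [DecidableEq A₂]

/-- A non-equilibrium profile can be played first in a subgame-perfect equilibrium if it becomes an
equilibrium once every outcome `o` is followed by a list `L o` of stage equilibria. -/
theorem GLSmp_of_continuation {u₁ u₂ : A₁ → A₂ → ℝ} {σ : Mix A₁} {a₂ : A₂} {M : ℕ}
    (L : A₁ → A₂ → List (Mix A₁ × A₂)) (hlen : ∀ a b, (L a b).length = M)
    (hL : ∀ a b, ∀ q ∈ L a b, q ∈ NashMP u₁ u₂)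
    (h₁ : BR1m (fun a b => u₁ a b + listPay u₁ (L a b)) σ (Mix.pure a₂))
    (h₂ : BR2pm (fun a b => u₂ a b + listPay u₂ (L a b)) σ a₂)
    (hσ : (σ, a₂) ∉ NashMP u₁ u₂) : GLSmp u₁ u₂ := by
  let s : Hist A₁ A₂ → Mix A₁ × A₂ := fun h => match h with
    | [] => (σ, a₂)
    | o :: t => (L o.1 o.2).getD t.length (σ, a₂)
  let μ₁ : Hist A₁ A₂ → Mix A₁ := fun h => (s h).1
  let μ₂ : Hist A₁ A₂ → A₂ := fun h => (s h).2
  have hs : ∀ (o : A₁ × A₂) (t : Hist A₁ A₂) (ht : t.length < (L o.1 o.2).length),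
      s (o :: t) = (L o.1 o.2)[t.length] := fun o t ht => by
    simp [s, List.getD, ht]
  have htot : ∀ (u : A₁ → A₂ → ℝ) (n : ℕ) (o : A₁ × A₂) (t : Hist A₁ A₂), t.length + n = M →
      totPay u μ₁ (pureBeh2 μ₂) n (o :: t) = listPay u ((L o.1 o.2).drop t.length) := by
    intro u n
    induction n with
    | zero =>
      intro o t ht
      rw [List.drop_eq_nil_of_le (by rw [hlen]; omega)]
      rfl
    | succ n ih =>
      intro o t ht
      have ht' : t.length < (L o.1 o.2).length := by rw [hlen]; omega
      have haug : augPay u μ₁ μ₂ n (o :: t) =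
          fun a b => u a b + listPay u ((L o.1 o.2).drop (t.length + 1)) := by
        funext a b
        unfold augPay
        rw [List.cons_append, ih o _ (by simp; omega)]
        simp
      rw [totPay_succ, haug, expPay_add_right u fun _ => _, List.drop_eq_getElem_cons ht',
        listPay_cons, ← hs o t ht']
  refine ⟨M + 1, by omega, μ₁, μ₂, isSPEmp_iff_oneShot.2 fun h n hT => ?_, [], by simp, hσ⟩
  cases h with
  | nil =>
    have haug : ∀ u : A₁ → A₂ → ℝ,
        augPay u μ₁ μ₂ n [] = fun a b => u a b + listPay u (L a b) := fun u => by
      funext a b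
      have hn : n = M := by simpa using hT
      unfold augPay
      rw [List.nil_append, htot u n _ _ (by simpa using hn)]
      simp
    rw [haug, haug]
    exact ⟨h₁, h₂⟩
  | cons o t =>
    rw [List.length_cons] at hT
    have haug : ∀ u : A₁ → A₂ → ℝ, augPay u μ₁ μ₂ n (o :: t) =
        fun a b => u a b + listPay u ((L o.1 o.2).drop (t.length + 1)) := fun u => by
      funext a b
      unfold augPay
      rw [List.cons_append, htot u n o _ (by simp; omega)]
      simp
    rw [haug, haug, mem_NashMP_add_const_iff]
    change s (o :: t) ∈ _
    rw [hs o t (by rw [hlen]; omega)]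
    exact hL _ _ _ (List.getElem_mem _)

theorem exists_nat_forall_le_mul {ι : Type*} [Finite ι] (f : ι → ℝ) {d : ℝ} (hd : 0 < d) :
    ∃ k : ℕ, ∀ i, f i ≤ k * d := by
  obtain ⟨C, hC⟩ := (Set.finite_range f).bddAbove
  obtain ⟨k, hk⟩ := exists_nat_ge (C / d)
  exact ⟨k, fun i => (hC ⟨i, rfl⟩).trans ((div_le_iff₀ hd).1 hk)⟩

theorem exists_lt_of_nontrivial_image {α : Type*} {f : α → ℝ} {s : Set α}
    (h : (f '' s).Nontrivial) : ∃ p ∈ s, ∃ q ∈ s, f q < f p := by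
  obtain ⟨_, ⟨q, hq, rfl⟩, _, ⟨p, hp, rfl⟩, hlt⟩ := h.exists_lt
  exact ⟨p, hp, q, hq, hlt⟩

theorem GLSmp_of_nontrivial_nontrivial {u₁ u₂ : A₁ → A₂ → ℝ} (hV₁ : (V1mp u₁ u₂).Nontrivial)
    (hV₂ : (V2mp u₁ u₂).Nontrivial) {q : Mix A₁ × A₂} (hq : q ∉ NashMP u₁ u₂) :
    GLSmp u₁ u₂ := by
  obtain ⟨a₁, a₂, ha⟩ := exists_pure_notMem_NashMP hq
  obtain ⟨p, hp, q, hq, hpq⟩ := exists_lt_of_nontrivial_image hV₁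
  obtain ⟨r, hr, s, hs, hrs⟩ := exists_lt_of_nontrivial_image hV₂
  obtain ⟨k, hk⟩ := exists_nat_forall_le_mul (fun a => u₁ a a₂ - u₁ a₁ a₂) (sub_pos.2 hpq)
  obtain ⟨m, hm⟩ := exists_nat_forall_le_mul (fun b => u₂ a₁ b - u₂ a₁ a₂) (sub_pos.2 hrs)
  refine GLSmp_of_continuation (M := k + m)
    (fun a b => List.replicate k (if a = a₁ then p else q) ++
      List.replicate m (if b = a₂ then r else s)) (by simp) ?_ ?_ ?_ ha
  · intro a b x hx
    rcases List.mem_append.1 hx with hx | hx <;> rw [List.eq_of_mem_replicate hx] <;>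
      split_ifs <;> assumption
  · refine BR1m_pure_iff.2 fun a h_mem a' => ?_
    obtain rfl : a = a₁ := by simpa [Mix.support_pure] using h_mem
    by_cases ha' : a' = a
    · rw [ha']
    · have := hk a'
      simp only [listPay_append, listPay_replicate, if_true, if_neg ha']
      linarith
  · intro b
    simp only [expPay_pure_pure]
    by_cases hb : b = a₂
    · simp [hb]
    · have := hm b
      simp only [listPay_append, listPay_replicate, if_true, if_neg hb]
      linarith

theorem GLSmp_of_nontrivial_oneVal {u₁ u₂ : A₁ → A₂ → ℝ} (hV₁ : (V1mp u₁ u₂).Nontrivial)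
    (hV₂ : oneVal (V2mp u₁ u₂)) {σ : Mix A₁} {a₁' : A₁} {a₂ : A₂}
    (hlt : expPay u₁ σ (Mix.pure a₂) < u₁ a₁' a₂) (hBR : BR2pm u₂ σ a₂)
    (hD : σ.support.Nontrivial → ∃ a ∈ σ.support, ∀ a' ∈ σ.support, a' ≠ a →
      sumOfD (Dmp u₁ u₂) (u₁ a a₂ - u₁ a' a₂)) : GLSmp u₁ u₂ := by
  classical
  obtain ⟨v, hv⟩ := hV₂
  have hv' : ∀ q ∈ NashMP u₁ u₂, expPay u₂ q.1 (Mix.pure q.2) = v := fun q hq => by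
    have : expPay u₂ q.1 (Mix.pure q.2) ∈ V2mp u₁ u₂ := ⟨q, hq, rfl⟩
    rwa [hv] at this
  obtain ⟨p, hp, q, hq, hpq⟩ := exists_lt_of_nontrivial_image hV₁
  obtain ⟨a, ha, haD⟩ : ∃ a ∈ σ.support, ∀ a' ∈ σ.support, a' ≠ a →
      sumOfD (Dmp u₁ u₂) (u₁ a a₂ - u₁ a' a₂) := by
    by_cases hs : σ.support.Nontrivial
    · exact hD hs
    · obtain ⟨a, ha⟩ := σ.support_nonempty
      exact ⟨a, ha, fun a' ha' hne => absurd (Set.not_nontrivial_iff.1 hs ha' ha) hne⟩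
  have hlists : ∀ a', ∃ l l' : List (Mix A₁ × A₂), (∀ q ∈ l, q ∈ NashMP u₁ u₂) ∧
      (∀ q ∈ l', q ∈ NashMP u₁ u₂) ∧ l.length = l'.length ∧
      (if a' ∈ σ.support then u₁ a a₂ - u₁ a' a₂ else 0) = listPay u₁ l - listPay u₁ l' := by
    intro a'
    rw [← sumOfD_Dmp_iff]
    have h0 : sumOfD (Dmp u₁ u₂) 0 := ⟨0, Fin.elim0, fun k => k.elim0, by simp⟩
    split_ifs with hs
    · by_cases hne : a' = a
      · simpa [hne] using h0
      · exact haD a' hs hne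
    · exact h0
  choose l l' hl hl' hll hpay using hlists
  obtain ⟨k, hk⟩ := exists_nat_forall_le_mul (fun a' => u₁ a' a₂ - u₁ a a₂) (sub_pos.2 hpq)
  let P : A₁ → List (Mix A₁ × A₂) := fun a' =>
    (Finset.univ.toList.flatMap fun c => if a' = c then l c else l' c)
  have hP : ∀ a', listPay u₁ (P a') =
      (∑ c, listPay u₁ (l' c)) + if a' ∈ σ.support then u₁ a a₂ - u₁ a' a₂ else 0 := by
    intro a'
    have hc : ∀ c, listPay u₁ (if a' = c then l c else l' c) =
        listPay u₁ (l' c) + if a' = c then listPay u₁ (l c) - listPay u₁ (l' c) else 0 := by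
      intro c
      split_ifs <;> ring
    rw [hpay, listPay_flatMap, Finset.sum_map_toList]
    simp only [hc, Finset.sum_add_distrib, Finset.sum_ite_eq, Finset.mem_univ, if_true]
  have hPlen : ∀ a', (P a').length = ∑ c, (l' c).length := by
    intro a'
    simp only [P, List.length_flatMap]
    rw [Finset.sum_map_toList]
    refine Finset.sum_congr rfl fun c _ => ?_
    split_ifs
    · exact hll c
    · rfl
  have hlen : ∀ a', (P a' ++ List.replicate k (if a' ∈ σ.support then p else q)).length =
      (∑ c, (l' c).length) + k := fun a' => by simp [hPlen]
  have hNash : ∀ a', ∀ x ∈ P a' ++ List.replicate k (if a' ∈ σ.support then p else q),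
      x ∈ NashMP u₁ u₂ := by
    intro a' x hx
    rcases List.mem_append.1 hx with hx | hx
    · obtain ⟨c, -, hc⟩ := List.mem_flatMap.1 hx
      split_ifs at hc
      · exact hl c x hc
      · exact hl' c x hc
    · rw [List.eq_of_mem_replicate hx]
      split_ifs <;> assumption
  refine GLSmp_of_continuation (σ := σ) (a₂ := a₂)
    (fun a' _ => P a' ++ List.replicate k (if a' ∈ σ.support then p else q))
    (fun a' _ => hlen a') (fun a' _ => hNash a') ?_ ?_ ?_
  · refine BR1m_pure_iff.2 fun b hb a' => ?_
    simp only [listPay_append, listPay_replicate, hP, if_pos hb]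
    by_cases ha' : a' ∈ σ.support
    · simp only [if_pos ha']
      linarith
    · have := hk a'
      simp only [if_neg ha']
      linarith
  · have hconst : ∀ a', listPay u₂ (P a' ++ List.replicate k (if a' ∈ σ.support then p else q)) =
        (((∑ c, (l' c).length) + k : ℕ) : ℝ) * v := fun a' => by
      rw [listPay_eq_length_mul fun x hx => hv' x (hNash a' x hx), hlen]
    simp only [hconst]
    exact BR2pm_add_const_iff.2 hBR
  · intro h
    have := h.1 (Mix.pure a₁')
    rw [expPay_pure_pure] at this
    exact absurd hlt (not_lt.2 this)

theorem GLSmp_of_BR1m_of_nontrivial {u₁ u₂ : A₁ → A₂ → ℝ}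
    (hV₂ : (V2mp u₁ u₂).Nontrivial) {σ : Mix A₁} {a₂ a₂' : A₂}
    (hlt : expPay u₂ σ (Mix.pure a₂) < expPay u₂ σ (Mix.pure a₂'))
    (hBR : BR1m u₁ σ (Mix.pure a₂)) : GLSmp u₁ u₂ := by
  obtain ⟨r, hr, s, hs, hrs⟩ := exists_lt_of_nontrivial_image hV₂
  obtain ⟨k, hk⟩ := exists_nat_forall_le_mul
    (fun b => expPay u₂ σ (Mix.pure b) - expPay u₂ σ (Mix.pure a₂)) (sub_pos.2 hrs)
  refine GLSmp_of_continuation (M := k) (fun _ b => List.replicate k (if b = a₂ then r else s))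
    (by simp) ?_ ?_ ?_ fun h => absurd hlt (not_lt.2 (h.2 a₂'))
  · intro a b x hx
    rw [List.eq_of_mem_replicate hx]
    split_ifs <;> assumption
  · exact (BR1m_add_right_iff
      (g := fun b => listPay u₁ (List.replicate k (if b = a₂ then r else s)))).2 hBR
  · intro b
    rw [expPay_add_right u₂ fun b => listPay u₂ (List.replicate k (if b = a₂ then r else s)),
      expPay_add_right u₂ fun b => listPay u₂ (List.replicate k (if b = a₂ then r else s))]
    by_cases hb : b = a₂
    · rw [hb]
    · have := hk b
      simp only [listPay_replicate, if_true, if_neg hb]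
      linarith

end Sufficiency

section Necessity

variable {A₁ A₂ : Type*} [Fintype A₁] [Fintype A₂] [DecidableEq A₁] [DecidableEq A₂]

/-- If stage equilibria are played from some round on and they all give the payoff `v`, then
continuation payoffs are multiples of `v`. -/
theorem totPay_eq_mul {u : A₁ → A₂ → ℝ} {S : Set (Mix A₁ × A₂)} {v : ℝ}
    (hv : ∀ q ∈ S, expPay u q.1 (Mix.pure q.2) = v) {μ₁ : Hist A₁ A₂ → Mix A₁}
    {μ₂ : Hist A₁ A₂ → A₂} {m T : ℕ}
    (hS : ∀ h : Hist A₁ A₂, m ≤ h.length → h.length < T → (μ₁ h, μ₂ h) ∈ S) (n : ℕ) :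
    ∀ h : Hist A₁ A₂, m ≤ h.length → h.length + n = T →
      totPay u μ₁ (pureBeh2 μ₂) n h = n * v := by
  induction n with
  | zero => intro h _ _; simp [totPay]
  | succ n ih =>
    intro h hm hT
    have haug : augPay u μ₁ μ₂ n h = fun a b => u a b + n * v := by
      funext a b
      unfold augPay
      rw [ih _ (by simp; omega) (by simp; omega)]
    rw [totPay_succ, haug, expPay_add_right u fun _ => (n : ℝ) * v, hv _ (hS h hm (by omega))]
    push_cast
    ring

/-- If stage equilibria are played from some round on, then player 1's continuation payoffs are
sums of stage-equilibrium payoffs. -/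
theorem exists_listPay_eq_totPay {u₁ u₂ : A₁ → A₂ → ℝ} {T m : ℕ} {μ₁ : Hist A₁ A₂ → Mix A₁}
    {μ₂ : Hist A₁ A₂ → A₂} (hμ : isSPEmp u₁ u₂ T μ₁ μ₂)
    (hS : ∀ h : Hist A₁ A₂, m ≤ h.length → h.length < T → (μ₁ h, μ₂ h) ∈ NashMP u₁ u₂) (n : ℕ) :
    ∀ h : Hist A₁ A₂, m ≤ h.length → h.length + n = T →
      ∃ l : List (Mix A₁ × A₂), (∀ q ∈ l, q ∈ NashMP u₁ u₂) ∧ l.length = n ∧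
        totPay u₁ μ₁ (pureBeh2 μ₂) n h = listPay u₁ l := by
  induction n with
  | zero => exact fun h _ _ => ⟨[], by simp, rfl, rfl⟩
  | succ n ih =>
    intro h hm hT
    obtain ⟨a, ha⟩ := (μ₁ h).support_nonempty
    obtain ⟨l, hl, hlen, hpay⟩ := ih (h ++ [(a, μ₂ h)]) (by simp; omega) (by simp; omega)
    have hN := hS h hm (by omega)
    refine ⟨(μ₁ h, μ₂ h) :: l, by simpa using ⟨hN, fun a b hab => hl (a, b) hab⟩,
      by simp [hlen], ?_⟩
    rw [totPay_succ, (isSPEmp_iff_oneShot.1 hμ h n hT).1.expPay_eq ha, listPay_cons,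
      hN.1.expPay_eq ha, ← hpay]
    rfl

theorem condMP_of_GLSmp [Nonempty A₁] [Nonempty A₂] {u₁ u₂ : A₁ → A₂ → ℝ}
    (H : GLSmp u₁ u₂) : condMP u₁ u₂ := by
  classical
  obtain ⟨T, hT, μ₁, μ₂, hμ, hbad⟩ := H
  have hos := isSPEmp_iff_oneShot.1 hμ
  obtain ⟨o⟩ : Nonempty (A₁ × A₂) := inferInstance
  obtain ⟨q, hq⟩ : (NashMP u₁ u₂).Nonempty := by
    have := hos (List.replicate (T - 1) o) 0 (by simp; omega)
    exact ⟨_, (mem_NashMP_add_const_iff (c₁ := 0) (c₂ := 0)).1 this⟩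
  have hex : ∃ n, ∃ h : Hist A₁ A₂, h.length + n + 1 = T ∧ (μ₁ h, μ₂ h) ∉ NashMP u₁ u₂ := by
    obtain ⟨h, hh, hN⟩ := hbad
    exact ⟨T - h.length - 1, h, by omega, hN⟩
  obtain ⟨h, hlen, hN⟩ := Nat.find_spec hex
  have hmin := fun k => @Nat.find_min _ _ hex k
  set n := Nat.find hex
  have hS : ∀ g : Hist A₁ A₂, h.length + 1 ≤ g.length → g.length < T →
      (μ₁ g, μ₂ g) ∈ NashMP u₁ u₂ := by
    intro g hg hgT
    by_contra hcon
    exact hmin (T - g.length - 1) (by omega) ⟨g, by omega, hcon⟩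
  obtain ⟨hBR₁, hBR₂⟩ := hos h n hlen
  have hone : ∀ (u : A₁ → A₂ → ℝ) (v : ℝ),
      (fun q : Mix A₁ × A₂ => expPay u q.1 (Mix.pure q.2)) '' NashMP u₁ u₂ = {v} →
      augPay u μ₁ μ₂ n h = fun a b => u a b + n * v := by
    intro u v hv
    funext a b
    unfold augPay
    rw [totPay_eq_mul (fun q hq => ?_) hS n _ (by simp) (by simp; omega)]
    exact (Set.ext_iff.1 hv _).1 ⟨q, hq, rfl⟩
  have hone₁ : ∀ v, V1mp u₁ u₂ = {v} → BR1m u₁ (μ₁ h) (Mix.pure (μ₂ h)) := fun v hv => by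
    rw [hone u₁ v hv] at hBR₁
    exact (BR1m_add_right_iff (g := fun _ => (n : ℝ) * v)).1 hBR₁
  have hone₂ : ∀ v, V2mp u₁ u₂ = {v} → BR2pm u₂ (μ₁ h) (μ₂ h) := fun v hv => by
    rw [hone u₂ v hv] at hBR₂
    exact BR2pm_add_const_iff.1 hBR₂
  have hV₁ := Set.eq_singleton_or_nontrivial
    (show expPay u₁ q.1 (Mix.pure q.2) ∈ V1mp u₁ u₂ from ⟨q, hq, rfl⟩)
  have hV₂ := Set.eq_singleton_or_nontrivial
    (show expPay u₂ q.1 (Mix.pure q.2) ∈ V2mp u₁ u₂ from ⟨q, hq, rfl⟩)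
  rcases hV₁ with hV₁ | hV₁ <;> rcases hV₂ with hV₂ | hV₂
  · exact absurd ⟨hone₁ _ hV₁, hone₂ _ hV₂⟩ hN
  · have h₁ := hone₁ _ hV₁
    have h₂ : ¬ BR2pm u₂ (μ₁ h) (μ₂ h) := fun h₂ => hN ⟨h₁, h₂⟩
    unfold BR2pm at h₂
    push Not at h₂
    obtain ⟨b, hb⟩ := h₂
    exact Or.inr (Or.inr ⟨⟨_, hV₁⟩, hV₂, μ₁ h, μ₂ h, b, hb, h₁⟩)
  · have h₂ := hone₂ _ hV₂
    have h₁ : ∃ a', expPay u₁ (μ₁ h) (Mix.pure (μ₂ h)) < u₁ a' (μ₂ h) := by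
      by_contra! hcon
      refine hN ⟨fun τ => ?_, h₂⟩
      rw [expPay_pure_right u₁ τ, ← τ.sum_mul_const (expPay u₁ (μ₁ h) (Mix.pure (μ₂ h)))]
      exact Finset.sum_le_sum fun a' _ => mul_le_mul_of_nonneg_left (hcon a') (τ.nonneg a')
    obtain ⟨a', ha'⟩ := h₁
    refine Or.inr (Or.inl ⟨hV₁, ⟨_, hV₂⟩, μ₁ h, a', μ₂ h, ha', h₂, fun _ => ?_⟩)
    obtain ⟨a, ha⟩ := (μ₁ h).support_nonempty
    refine ⟨a, ha, fun c hc _ => sumOfD_Dmp_iff.2 ?_⟩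
    obtain ⟨l, hl, hll, hlp⟩ :=
      exists_listPay_eq_totPay hμ hS n (h ++ [(a, μ₂ h)]) (by simp) (by simp; omega)
    obtain ⟨l', hl', hll', hlp'⟩ :=
      exists_listPay_eq_totPay hμ hS n (h ++ [(c, μ₂ h)]) (by simp) (by simp; omega)
    refine ⟨l', l, hl', hl, hll'.trans hll.symm, ?_⟩
    have e : augPay u₁ μ₁ μ₂ n h a (μ₂ h) = augPay u₁ μ₁ μ₂ n h c (μ₂ h) :=
      (hBR₁.expPay_eq ha).symm.trans (hBR₁.expPay_eq hc)
    unfold augPay at e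
    rw [hlp, hlp'] at e
    linarith
  · exact Or.inl ⟨hV₁, hV₂, μ₁ h, μ₂ h, hN⟩

end Necessity

section TwoPlayer
variable {A₁ A₂ : Type*} [Fintype A₁] [Fintype A₂] [DecidableEq A₁] [DecidableEq A₂]
variable [Nonempty A₁] [Nonempty A₂]

/-- Theorem (2-player, pure against mixed): local suboptimality occurs in some SPE of
some finitely repeated game `G(T)` (player 1 mixed, player 2 pure) iff the mixed-pure
condition holds. -/
theorem localSuboptimality_mixedPure_iff (u₁ u₂ : A₁ → A₂ → ℝ) :
    GLSmp u₁ u₂ ↔ condMP u₁ u₂ := by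
  refine ⟨condMP_of_GLSmp, ?_⟩
  rintro (⟨hV₁, hV₂, σ, a₂, h⟩ | ⟨hV₁, hV₂, σ, a₁', a₂, hlt, hBR, hD⟩ |
    ⟨-, hV₂, σ, a₂, a₂', hlt, hBR⟩)
  · exact GLSmp_of_nontrivial_nontrivial hV₁ hV₂ h
  · exact GLSmp_of_nontrivial_oneVal hV₁ hV₂ hlt hBR hD
  · exact GLSmp_of_BR1m_of_nontrivial hV₂ hlt hBR

end TwoPlayer
end

section
/- 𝒢_LS^{p,p} ⊆ 𝒢_LS^{m,p}: for every 2-player stage game G, if there exist some T ≥ 1 and some subgame-perfect equilibrium of G(T) in which local suboptimality occurs when both players are restricted to pure strategies, then there exist some T ≥ 1 and some subgame-perfect equilibrium of G(T) in which local suboptimality occurs when player 1 may use mixed strategies and player 2 is restricted to pure strategies. -/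
open Finset

lemma Mix.sum_pure_mul {A : Type*} [Fintype A] [DecidableEq A] (a : A) (f : A → ℝ) :
    ∑ b, (Mix.pure a).p b * f b = f a := by
  simp [Mix.pure]

lemma Mix.sum_mul_le {A : Type*} [Fintype A] (σ : Mix A) {f : A → ℝ} {c : ℝ}
    (hf : ∀ a, f a ≤ c) : ∑ a, σ.p a * f a ≤ c :=
  calc ∑ a, σ.p a * f a ≤ ∑ a, σ.p a * c :=
        Finset.sum_le_sum fun a _ => mul_le_mul_of_nonneg_left (hf a) (σ.nonneg a)
    _ = c := by rw [← Finset.sum_mul, σ.sum_one, one_mul]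

section PureReplies

variable {A₁ A₂ : Type*} [Fintype A₁] [Fintype A₂] [DecidableEq A₂]

lemma totPay_succ_pureBeh2 (u : A₁ → A₂ → ℝ) (μ₁ : Hist A₁ A₂ → Mix A₁)
    (μ₂ : Hist A₁ A₂ → A₂) (n : ℕ) (h : Hist A₁ A₂) :
    totPay u μ₁ (pureBeh2 μ₂) (n + 1) h =
      ∑ a, (μ₁ h).p a *
        (u a (μ₂ h) + totPay u μ₁ (pureBeh2 μ₂) n (h ++ [(a, μ₂ h)])) := by
  simp only [totPay, pureBeh2, mul_assoc, ← Finset.mul_sum, Mix.sum_pure_mul]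

/-- The best total payoff over `n` remaining rounds after `h` against the pure strategy `μ₂`. -/
noncomputable def bestPay (u : A₁ → A₂ → ℝ) (μ₂ : Hist A₁ A₂ → A₂) : ℕ → Hist A₁ A₂ → ℝ
  | 0, _ => 0
  | n + 1, h => ⨆ a, (u a (μ₂ h) + bestPay u μ₂ n (h ++ [(a, μ₂ h)]))

lemma totPay_le_bestPay (u : A₁ → A₂ → ℝ) (μ₁ : Hist A₁ A₂ → Mix A₁)
    (μ₂ : Hist A₁ A₂ → A₂) (n : ℕ) (h : Hist A₁ A₂) :
    totPay u μ₁ (pureBeh2 μ₂) n h ≤ bestPay u μ₂ n h := by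
  induction n generalizing h with
  | zero => exact le_rfl
  | succ n ih =>
    rw [totPay_succ_pureBeh2]
    refine (μ₁ h).sum_mul_le fun a => (add_le_add_right (ih _) _).trans ?_
    exact le_ciSup (f := fun a => u a (μ₂ h) + bestPay u μ₂ n (h ++ [(a, μ₂ h)]))
      (Set.finite_range _).bddAbove a

variable [DecidableEq A₁]

lemma expPay_pure_pure_s7 (u : A₁ → A₂ → ℝ) (a₁ : A₁) (a₂ : A₂) :
    expPay u (Mix.pure a₁) (Mix.pure a₂) = u a₁ a₂ := by
  simp only [expPay, mul_assoc, ← Finset.mul_sum, Mix.sum_pure_mul]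

lemma mem_NashPP_of_pure_mem_NashMP {u₁ u₂ : A₁ → A₂ → ℝ} {a₁ : A₁} {a₂ : A₂}
    (h : (Mix.pure a₁, a₂) ∈ NashMP u₁ u₂) : (a₁, a₂) ∈ NashPP u₁ u₂ :=
  ⟨fun b₁ => by simpa only [expPay_pure_pure_s7] using h.1 (Mix.pure b₁),
    fun b₂ => by simpa only [expPay_pure_pure_s7] using h.2 b₂⟩

lemma totPay_succ_pureBeh1_pureBeh2 (u : A₁ → A₂ → ℝ) (μ₁ : Hist A₁ A₂ → A₁)
    (μ₂ : Hist A₁ A₂ → A₂) (n : ℕ) (h : Hist A₁ A₂) :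
    totPay u (pureBeh1 μ₁) (pureBeh2 μ₂) (n + 1) h =
      u (μ₁ h) (μ₂ h) + totPay u (pureBeh1 μ₁) (pureBeh2 μ₂) n (h ++ [(μ₁ h, μ₂ h)]) := by
  rw [totPay_succ_pureBeh2, pureBeh1, Mix.sum_pure_mul]

lemma exists_pure_totPay_eq_bestPay [Nonempty A₁] (u : A₁ → A₂ → ℝ)
    (μ₂ : Hist A₁ A₂ → A₂) (T : ℕ) :
    ∃ ν : Hist A₁ A₂ → A₁, ∀ n h, h.length + n = T →
      totPay u (pureBeh1 ν) (pureBeh2 μ₂) n h = bestPay u μ₂ n h := by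
  choose ν hν using fun h : Hist A₁ A₂ => exists_eq_ciSup_of_finite
    (f := fun a => u a (μ₂ h) + bestPay u μ₂ (T - h.length - 1) (h ++ [(a, μ₂ h)]))
  refine ⟨ν, fun n => ?_⟩
  induction n with
  | zero => exact fun _ _ => rfl
  | succ n ih =>
    intro h hn
    have hT : T - h.length - 1 = n := by omega
    have hνh := hν h
    rw [hT] at hνh
    rw [totPay_succ_pureBeh1_pureBeh2, ih _ (by simp; omega)]
    exact hνh

lemma isNEpp.isNEmp [Nonempty A₁] {u₁ u₂ : A₁ → A₂ → ℝ} {T : ℕ}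
    {μ₁ : Hist A₁ A₂ → A₁} {μ₂ : Hist A₁ A₂ → A₂} (h : isNEpp u₁ u₂ T μ₁ μ₂) :
    isNEmp u₁ u₂ T (pureBeh1 μ₁) μ₂ := by
  refine ⟨fun μ₁' => ?_, h.2⟩
  obtain ⟨ν, hν⟩ := exists_pure_totPay_eq_bestPay u₁ μ₂ T
  calc totPay u₁ μ₁' (pureBeh2 μ₂) T [] ≤ bestPay u₁ μ₂ T [] := totPay_le_bestPay ..
    _ = totPay u₁ (pureBeh1 ν) (pureBeh2 μ₂) T [] := (hν T [] (by simp)).symm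
    _ ≤ totPay u₁ (pureBeh1 μ₁) (pureBeh2 μ₂) T [] := h.1 ν

end PureReplies

section TwoPlayer
variable {A₁ A₂ : Type*} [Fintype A₁] [Fintype A₂] [DecidableEq A₁] [DecidableEq A₂]
variable [Nonempty A₁] [Nonempty A₂]

/-- `𝒢_LS^{p,p} ⊆ 𝒢_LS^{m,p}`. -/
theorem GLSpp_subset_GLSmp (u₁ u₂ : A₁ → A₂ → ℝ) (h : GLSpp u₁ u₂) :
    GLSmp u₁ u₂ := by
  obtain ⟨T, hT, μ₁, μ₂, hspe, k, hk, hls⟩ := h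
  exact ⟨T, hT, pureBeh1 μ₁, μ₂, fun h' hh' => (hspe h' hh').isNEmp, k, hk,
    fun hN => hls (mem_NashPP_of_pure_mem_NashMP hN)⟩

end TwoPlayer
end
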